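/- The jump relations γ₀𝒟⁺ = −I/2 + D and γ₀𝒟⁻ = I/2 + D hold, where I is the ∂Ω×∂Ω identity matrix. -/

import Mathlib

open Matrix BigOperators

noncomputable section

variable {V : Type*} [Fintype V] [DecidableEq V]

/-- Weighted graph Laplacian of a symmetric weight function. -/
def lap (σ : V → V → ℝ) : Matrix V V ℝ :=
  Matrix.of fun x y => if x = y then ∑ z, σ x z else -σ x y

/-- Restriction matrix `R_X : ℝ^V → ℝ^X`. -/
def restr (X : Finset V) : Matrix {x // x ∈ X} V ℝ :=
  Matrix.of fun i j => if (i : V) = j then 1 else 0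

/-- Green function `G = R_{V°}ᵀ (L[V°,V°])⁻¹ R_{V°}` with `V° = Bᶜ`. -/
def green (B : Finset V) (σ : V → V → ℝ) : Matrix V V ℝ :=
  (restr Bᶜ)ᵀ * (restr Bᶜ * lap σ * (restr Bᶜ)ᵀ)⁻¹ * restr Bᶜ

/-- Dirichlet trace operator `γ₀ = R_{∂Ω}`. -/
def gamma0 (dO : Finset V) : Matrix {x // x ∈ dO} V ℝ := restr dO

/-- Exterior Neumann trace operator `γ₁⁺ = -R_{∂Ω} L(σ⁺)`. -/
def gamma1p (dO : Finset V) (σp : V → V → ℝ) : Matrix {x // x ∈ dO} V ℝ :=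
  -(restr dO * lap σp)

/-- Interior Neumann trace operator `γ₁⁻ = R_{∂Ω} L(σ⁻)`. -/
def gamma1m (dO : Finset V) (σm : V → V → ℝ) : Matrix {x // x ∈ dO} V ℝ :=
  restr dO * lap σm

/-- Single layer potential `𝒮 = G γ₀ᵀ`. -/
def slp (B dO : Finset V) (σ : V → V → ℝ) : Matrix V {x // x ∈ dO} ℝ :=
  green B σ * (gamma0 dO)ᵀ

/-- Exterior double layer potential `𝒟⁺ = G (γ₁⁺)ᵀ`. -/
def dlpP (B dO : Finset V) (σ σp : V → V → ℝ) : Matrix V {x // x ∈ dO} ℝ :=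
  green B σ * (gamma1p dO σp)ᵀ

/-- Interior double layer potential `𝒟⁻ = G (γ₁⁻)ᵀ`. -/
def dlpM (B dO : Finset V) (σ σm : V → V → ℝ) : Matrix V {x // x ∈ dO} ℝ :=
  green B σ * (gamma1m dO σm)ᵀ

/-- Single layer boundary operator `S = γ₀ 𝒮`. -/
def Sop (B dO : Finset V) (σ : V → V → ℝ) : Matrix {x // x ∈ dO} {x // x ∈ dO} ℝ :=
  gamma0 dO * slp B dO σ

/-- Double layer boundary operator `D = ½ γ₀ (𝒟⁺ + 𝒟⁻)`. -/
def Dop (B dO : Finset V) (σ σp σm : V → V → ℝ) : Matrix {x // x ∈ dO} {x // x ∈ dO} ℝ :=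
  (1/2 : ℝ) • (gamma0 dO * (dlpP B dO σ σp + dlpM B dO σ σm))

/-- Adjoint double layer (Neumann–Poincaré) operator `D' = ½ (γ₁⁺ + γ₁⁻) 𝒮`. -/
def Dadj (B dO : Finset V) (σ σp σm : V → V → ℝ) : Matrix {x // x ∈ dO} {x // x ∈ dO} ℝ :=
  (1/2 : ℝ) • ((gamma1p dO σp + gamma1m dO σm) * slp B dO σ)

/-- Hypersingular operator `H = -γ₁⁺ 𝒟⁻`. -/
def Hop (B dO : Finset V) (σ σp σm : V → V → ℝ) : Matrix {x // x ∈ dO} {x // x ∈ dO} ℝ :=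
  -(gamma1p dO σp * dlpM B dO σ σm)

/-- Indicator vector of a node subset. -/
def ind (X : Finset V) : V → ℝ := fun x => if x ∈ X then 1 else 0

/-- The subgraph with node set `A` and edges `{x,y}` with `w x y > 0` is connected. -/
def connOn (A : Finset V) (w : V → V → ℝ) : Prop :=
  ∀ x ∈ A, ∀ y ∈ A, Relation.ReflTransGen (fun a b => a ∈ A ∧ b ∈ A ∧ 0 < w a b) x y

lemma lap_add (σ τ : V → V → ℝ) :
    lap (fun x y => σ x y + τ x y) = lap σ + lap τ := by
  ext x y
  by_cases h : x = y
  · simp [lap, h, Finset.sum_add_distrib]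
  · simp [lap, h, add_comm]

lemma lap_transpose (σ : V → V → ℝ) (hσ : ∀ x y, σ x y = σ y x) : (lap σ)ᵀ = lap σ := by
  ext x y
  by_cases h : x = y
  · simp [h]
  · simp [lap, h, Ne.symm h, hσ x y]

lemma restr_mul_transpose (X : Finset V) : restr X * (restr X)ᵀ = 1 := by
  ext i j
  by_cases h : i = j
  · subst h
    simp [restr, Matrix.mul_apply]
  · simp [restr, Matrix.mul_apply, h]

lemma restr_mul_transpose_mul_of_subset {X Y : Finset V} (h : X ⊆ Y) :
    restr X * ((restr Y)ᵀ * restr Y) = restr X := by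
  have hdiag : (restr Y)ᵀ * restr Y = Matrix.diagonal fun v => if v ∈ Y then (1 : ℝ) else 0 := by
    ext u v
    simp only [Matrix.mul_apply, Matrix.transpose_apply, restr, Matrix.of_apply,
      Finset.univ_eq_attach]
    rw [Finset.sum_attach Y (fun w => (if w = u then (1 : ℝ) else 0) * if w = v then 1 else 0)]
    by_cases huv : u = v
    · simp [huv]
    · simp [huv, Ne.symm huv]
  ext i v
  rw [hdiag, Matrix.mul_diagonal]
  by_cases hiv : (i : V) = v
  · simp [restr, ← hiv, h i.2]
  · simp [restr, hiv]

/-- The Green function inverts the Laplacian between nodes outside the Dirichlet set `B`. -/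
lemma restr_mul_green_mul_lap_mul_transpose {B X : Finset V} (σ : V → V → ℝ)
    (hBX : X ⊆ Bᶜ) (hpd : (restr Bᶜ * lap σ * (restr Bᶜ)ᵀ).PosDef) :
    restr X * (green B σ * (lap σ * (restr X)ᵀ)) = 1 := by
  have hE := restr_mul_transpose_mul_of_subset hBX
  have hEt : (restr X)ᵀ = (restr Bᶜ)ᵀ * (restr Bᶜ * (restr X)ᵀ) := by
    simpa [Matrix.transpose_mul, Matrix.mul_assoc] using (congrArg Matrix.transpose hE).symm
  have hdet := (Matrix.isUnit_iff_isUnit_det _).mp hpd.isUnit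
  have hinv := Matrix.nonsing_inv_mul _ hdet
  calc restr X * (green B σ * (lap σ * (restr X)ᵀ))
      = restr X * (green B σ * (lap σ * ((restr Bᶜ)ᵀ * (restr Bᶜ * (restr X)ᵀ)))) := by
        rw [← hEt]
    _ = restr X * ((restr Bᶜ)ᵀ * (((restr Bᶜ * lap σ * (restr Bᶜ)ᵀ)⁻¹ *
          (restr Bᶜ * lap σ * (restr Bᶜ)ᵀ)) * (restr Bᶜ * (restr X)ᵀ))) := by
        simp only [green, Matrix.mul_assoc]
    _ = 1 := by
        rw [hinv, Matrix.one_mul, ← hEt, restr_mul_transpose]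

theorem stmt_6
    {V : Type*} [Fintype V] [DecidableEq V]
    (B Op dO Om : Finset V)
    (hBne : B.Nonempty) (hOpne : Op.Nonempty) (hdOne : dO.Nonempty) (hOmne : Om.Nonempty)
    (hd1 : Disjoint B Op) (hd2 : Disjoint B dO) (hd3 : Disjoint B Om)
    (hd4 : Disjoint Op dO) (hd5 : Disjoint Op Om) (hd6 : Disjoint dO Om)
    (hcover : B ∪ Op ∪ dO ∪ Om = Finset.univ)
    (σ σp σm : V → V → ℝ)
    (hσsymm : ∀ x y, σ x y = σ y x) (hσdiag : ∀ x, σ x x = 0)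
    (hσnn : ∀ x y, 0 ≤ σ x y)
    (hsepBdO : ∀ x ∈ B, ∀ y ∈ dO, σ x y = 0)
    (hsepBOm : ∀ x ∈ B, ∀ y ∈ Om, σ x y = 0)
    (hsepOpOm : ∀ x ∈ Op, ∀ y ∈ Om, σ x y = 0)
    (hσpsymm : ∀ x y, σp x y = σp y x) (hσpdiag : ∀ x, σp x x = 0)
    (hσmsymm : ∀ x y, σm x y = σm y x) (hσmdiag : ∀ x, σm x x = 0)
    (hσpnn : ∀ x y, 0 ≤ σp x y) (hσmnn : ∀ x y, 0 ≤ σm x y)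
    (hsum : ∀ x y, σp x y + σm x y = σ x y)
    (hp1 : ∀ x y, x ∈ B ∪ Op ∨ y ∈ B ∪ Op → σp x y = σ x y)
    (hm1 : ∀ x y, x ∈ Om ∨ y ∈ Om → σm x y = σ x y)
    (hpd : (restr Bᶜ * lap σ * (restr Bᶜ)ᵀ).PosDef) :
    gamma0 dO * dlpP B dO σ σp = (-(1/2) : ℝ) • (1 : Matrix {x // x ∈ dO} {x // x ∈ dO} ℝ) + Dop B dO σ σp σm
    ∧ gamma0 dO * dlpM B dO σ σm = ((1/2) : ℝ) • (1 : Matrix {x // x ∈ dO} {x // x ∈ dO} ℝ) + Dop B dO σ σp σm := by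
  have hlap : lap σ = lap σp + lap σm := by
    rw [← lap_add]
    simp only [hsum]
  have hsub : dO ⊆ Bᶜ := fun x hx =>
    Finset.mem_compl.mpr fun hB => Finset.disjoint_left.mp hd2 hB hx
  have hjump : gamma0 dO * dlpM B dO σ σm = 1 + gamma0 dO * dlpP B dO σ σp := by
    rw [← restr_mul_green_mul_lap_mul_transpose σ hsub hpd]
    simp only [gamma0, dlpM, dlpP, gamma1m, gamma1p, Matrix.transpose_mul, Matrix.transpose_neg,
      lap_transpose _ hσpsymm, lap_transpose _ hσmsymm, Matrix.mul_neg]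
    rw [← sub_eq_add_neg, ← Matrix.mul_sub, ← Matrix.mul_sub, ← Matrix.sub_mul, hlap,
      add_sub_cancel_left]
  rw [Dop, Matrix.mul_add, hjump]
  constructor <;> module
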